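/- Let Z = {Z^M_{n,i} : 1 ≤ n ≤ M, 1 ≤ i ≤ K} be an array of ℕ-valued random variables satisfying PAI(Z) with limit Z̃. Then for every i ∈ {1,…,K}, the array Z_i = {Z^M_{n,i} : 1 ≤ n ≤ M} satisfies TLLN(Z_i) with limit Z̃: for every function f : ℕ → ℝ with finite support, (1/M) Σ_{n=1}^M f(Z^M_{n,i}) converges in L² to the constant E[f(Z̃)] as M → ∞. -/

import Mathlib

open MeasureTheory ProbabilityTheory Filter
open scoped ProbabilityTheory

noncomputable section

/-- Pairwise asymptotic independence (PAI) of an array `Z = {Z^M_{n,i}}` of `ℕ`-valued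
random variables with limit `Zt`. -/
def PAI {Ω : Type*} [MeasureSpace Ω] {K : ℕ}
    (Z : ℕ → ℕ → Fin K → Ω → ℕ) (Zt : Ω → ℕ) : Prop :=
  ∀ (n m : ℕ) (i j : Fin K), (n, i) ≠ (m, j) →
    ∀ u v : ℝ, u ∈ Set.Icc (0:ℝ) 1 → v ∈ Set.Icc (0:ℝ) 1 →
      Tendsto (fun M : ℕ => ∫ ω, u ^ (Z M n i ω) * v ^ (Z M m j ω)) atTop
        (nhds ((∫ ω, u ^ (Zt ω)) * (∫ ω, v ^ (Zt ω))))

/-- Exchangeability in `(n,i)` of the array `{Z^M_{n,i}}`, for each fixed `M`. -/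
def ExchangeablePairs {Ω : Type*} [MeasureSpace Ω] {K : ℕ}
    (Z : ℕ → ℕ → Fin K → Ω → ℕ) : Prop :=
  ∀ (M : ℕ) (π : Equiv.Perm (ℕ × Fin K)), (∀ p : ℕ × Fin K, M ≤ p.1 → π p = p) →
    Measure.map (fun ω (p : ℕ × Fin K) => Z M (π p).1 (π p).2 ω) ℙ
      = Measure.map (fun ω (p : ℕ × Fin K) => Z M p.1 p.2 ω) ℙ

section EmpiricalMeans

variable {Ω : Type*} [MeasureSpace Ω] {W : ℕ → ℕ → Ω → ℕ} {Wt : Ω → ℕ}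

/-- The deviation of the empirical mean of `g` along the `M`-th row of `W` from its target. -/
def meanDeviation (W : ℕ → ℕ → Ω → ℕ) (Wt : Ω → ℕ) (g : ℕ → ℝ) (M : ℕ) (ω : Ω) : ℝ :=
  (M : ℝ)⁻¹ * ∑ n ∈ Finset.range M, g (W M n ω) - ∫ ω', g (Wt ω')

/-- The function `g` is bounded and its empirical means converge in `L²`. -/
def BoundedL2Law (W : ℕ → ℕ → Ω → ℕ) (Wt : Ω → ℕ) (g : ℕ → ℝ) : Prop :=
  (∃ C, ∀ x, |g x| ≤ C) ∧
    Tendsto (fun M => ∫ ω, meanDeviation W Wt g M ω ^ 2) atTop (nhds 0)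

namespace BoundedL2Law

lemma const_mul {g : ℕ → ℝ} (hg : BoundedL2Law W Wt g) (c : ℝ) :
    BoundedL2Law W Wt (fun x => c * g x) := by
  obtain ⟨⟨C, hC⟩, hg⟩ := hg
  refine ⟨⟨|c| * C, fun x => ?_⟩, ?_⟩
  · rw [abs_mul]
    exact mul_le_mul_of_nonneg_left (hC x) (abs_nonneg c)
  · have h := hg.const_mul (c ^ 2)
    rw [mul_zero] at h
    refine h.congr fun M => ?_
    rw [← integral_const_mul]
    congr 1 with ω
    simp only [meanDeviation, integral_const_mul, ← Finset.mul_sum]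
    ring

lemma zero : BoundedL2Law W Wt (fun _ => 0) :=
  ⟨⟨0, by simp⟩, by simp [meanDeviation]⟩

end BoundedL2Law

variable [IsProbabilityMeasure (ℙ : Measure Ω)]

lemma integrable_comp_nat_of_bounded {X : Ω → ℕ} (hX : Measurable X) {g : ℕ → ℝ} {C : ℝ}
    (hg : ∀ x, |g x| ≤ C) : Integrable (fun ω => g (X ω)) :=
  Integrable.of_bound ((measurable_of_countable g).comp hX).aestronglyMeasurable C
    (Eventually.of_forall fun _ => hg _)

lemma abs_meanDeviation_le {g : ℕ → ℝ} {C : ℝ} (hg : ∀ x, |g x| ≤ C) (M : ℕ) (ω : Ω) :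
    |meanDeviation W Wt g M ω| ≤ 2 * C := by
  have hC : 0 ≤ C := (abs_nonneg _).trans (hg 0)
  have h1 : |(M : ℝ)⁻¹ * ∑ n ∈ Finset.range M, g (W M n ω)| ≤ C := by
    rw [abs_mul, abs_of_nonneg (by positivity : (0 : ℝ) ≤ (M : ℝ)⁻¹)]
    have hs : |∑ n ∈ Finset.range M, g (W M n ω)| ≤ M * C := by
      refine (Finset.abs_sum_le_sum_abs _ _).trans ?_
      refine (Finset.sum_le_sum fun n _ => hg _).trans ?_
      simp
    rcases Nat.eq_zero_or_pos M with rfl | hM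
    · simpa using hC
    · have hM' : (0 : ℝ) < M := by exact_mod_cast hM
      rw [inv_mul_le_iff₀ hM']
      exact hs
  have h2 : |∫ ω', g (Wt ω')| ≤ C := by
    have := norm_integral_le_of_norm_le_const (μ := (ℙ : Measure Ω))
      (f := fun ω' => g (Wt ω')) (C := C) (Eventually.of_forall fun ω' => hg _)
    simpa using this
  unfold meanDeviation
  exact (abs_sub _ _).trans (by linarith)

lemma integrable_sq_meanDeviation (hW : ∀ M n, Measurable (W M n)) {g : ℕ → ℝ} {C : ℝ}
    (hg : ∀ x, |g x| ≤ C) (M : ℕ) :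
    Integrable (fun ω => meanDeviation W Wt g M ω ^ 2) := by
  have hm : Measurable (fun ω => meanDeviation W Wt g M ω) := by
    unfold meanDeviation
    exact ((Finset.measurable_sum _ fun n _ =>
      (measurable_of_countable g).comp (hW M n)).const_mul _).sub_const _
  refine Integrable.of_bound (hm.pow_const 2).aestronglyMeasurable ((2 * C) ^ 2)
    (Eventually.of_forall fun ω => ?_)
  rw [Real.norm_eq_abs, abs_pow]
  exact pow_le_pow_left₀ (abs_nonneg _) (abs_meanDeviation_le hg M ω) 2

lemma meanDeviation_add (hWt : Measurable Wt) {g h : ℕ → ℝ} {C D : ℝ}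
    (hg : ∀ x, |g x| ≤ C) (hh : ∀ x, |h x| ≤ D) (M : ℕ) (ω : Ω) :
    meanDeviation W Wt (fun x => g x + h x) M ω =
      meanDeviation W Wt g M ω + meanDeviation W Wt h M ω := by
  unfold meanDeviation
  rw [integral_add (integrable_comp_nat_of_bounded hWt hg)
    (integrable_comp_nat_of_bounded hWt hh), Finset.sum_add_distrib]
  ring

namespace BoundedL2Law

lemma add (hW : ∀ M n, Measurable (W M n)) (hWt : Measurable Wt) {g h : ℕ → ℝ}
    (hg : BoundedL2Law W Wt g) (hh : BoundedL2Law W Wt h) :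
    BoundedL2Law W Wt (fun x => g x + h x) := by
  obtain ⟨⟨C, hC⟩, hg⟩ := hg
  obtain ⟨⟨D, hD⟩, hh⟩ := hh
  refine ⟨⟨C + D, fun x => (abs_add_le _ _).trans (add_le_add (hC x) (hD x))⟩, ?_⟩
  have hlim := (hg.const_mul 2).add (hh.const_mul 2)
  simp only [mul_zero, add_zero] at hlim
  refine squeeze_zero (fun M => integral_nonneg fun ω => sq_nonneg _) (fun M => ?_) hlim
  have i1 := integrable_sq_meanDeviation (Wt := Wt) hW hC M
  have i2 := integrable_sq_meanDeviation (Wt := Wt) hW hD M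
  rw [← integral_const_mul, ← integral_const_mul,
    ← integral_add (i1.const_mul 2) (i2.const_mul 2)]
  refine integral_mono_of_nonneg (Eventually.of_forall fun ω => sq_nonneg _)
    ((i1.const_mul 2).add (i2.const_mul 2)) (Eventually.of_forall fun ω => ?_)
  simp only [meanDeviation_add hWt hC hD]
  nlinarith [sq_nonneg (meanDeviation W Wt g M ω - meanDeviation W Wt h M ω)]

lemma sum (hW : ∀ M n, Measurable (W M n)) (hWt : Measurable Wt) {ι : Type*} (s : Finset ι)
    {g : ι → ℕ → ℝ} (hg : ∀ k ∈ s, BoundedL2Law W Wt (g k)) :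
    BoundedL2Law W Wt (fun x => ∑ k ∈ s, g k x) := by
  classical
  induction s using Finset.induction_on with
  | empty => simpa using zero
  | insert a s ha ih =>
    simp only [Finset.sum_insert ha]
    exact add hW hWt (hg a (Finset.mem_insert_self a s))
      (ih fun k hk => hg k (Finset.mem_insert_of_mem hk))

/-- The class of functions obeying the law is closed under uniform limits. -/
lemma of_uniform_approx (hW : ∀ M n, Measurable (W M n)) (hWt : Measurable Wt) {g : ℕ → ℝ}
    (happ : ∀ ε : ℝ, 0 < ε → ε ≤ 1 → ∃ h, BoundedL2Law W Wt h ∧ ∀ x, |g x - h x| ≤ ε) :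
    BoundedL2Law W Wt g := by
  refine ⟨?_, ?_⟩
  · obtain ⟨h, ⟨⟨C, hC⟩, -⟩, hgh⟩ := happ 1 one_pos le_rfl
    refine ⟨1 + C, fun x => ?_⟩
    have := abs_add_le (g x - h x) (h x)
    rw [sub_add_cancel] at this
    linarith [hgh x, hC x]
  · rw [Metric.tendsto_atTop]
    intro δ hδ
    obtain ⟨ε, hε, hε1, hεδ⟩ : ∃ ε : ℝ, 0 < ε ∧ ε ≤ 1 ∧ 16 * ε ≤ δ :=
      ⟨min 1 (δ / 16), by positivity, min_le_left _ _, by linarith [min_le_right 1 (δ / 16)]⟩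
    obtain ⟨h, ⟨⟨C, hC⟩, hlim⟩, hgh⟩ := happ ε hε hε1
    obtain ⟨N, hN⟩ := Metric.tendsto_atTop.1 hlim (δ / 4) (by positivity)
    refine ⟨N, fun M hM => ?_⟩
    have hM := hN M hM
    have n1 : 0 ≤ ∫ ω, meanDeviation W Wt h M ω ^ 2 := integral_nonneg fun ω => sq_nonneg _
    have n2 : 0 ≤ ∫ ω, meanDeviation W Wt g M ω ^ 2 := integral_nonneg fun ω => sq_nonneg _
    rw [Real.dist_eq, sub_zero, abs_of_nonneg n1] at hM
    rw [Real.dist_eq, sub_zero, abs_of_nonneg n2]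
    have i1 := integrable_sq_meanDeviation (Wt := Wt) hW hC M
    have key : ∫ ω, meanDeviation W Wt g M ω ^ 2 ≤
        ∫ ω, (2 * meanDeviation W Wt h M ω ^ 2 + 8 * ε ^ 2) := by
      refine integral_mono_of_nonneg (Eventually.of_forall fun ω => sq_nonneg _)
        ((i1.const_mul 2).add (integrable_const _)) (Eventually.of_forall fun ω => ?_)
      have e := meanDeviation_add (W := W) hWt hgh hC M ω
      simp only [sub_add_cancel] at e
      have b := sq_le_sq' (abs_le.1 (abs_meanDeviation_le (W := W) (Wt := Wt) hgh M ω)).1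
        (abs_le.1 (abs_meanDeviation_le (W := W) (Wt := Wt) hgh M ω)).2
      change meanDeviation W Wt (fun x => g x) M ω ^ 2 ≤ _
      rw [e]
      nlinarith [sq_nonneg (meanDeviation W Wt (fun x => g x - h x) M ω
        - meanDeviation W Wt h M ω)]
    rw [integral_add (i1.const_mul 2) (integrable_const _), integral_const_mul,
      integral_const, probReal_univ, one_smul] at key
    nlinarith

/-- Point indicators are uniform limits of combinations of the functions `x ↦ u ^ x`. -/
lemma indicator_of_pow (hW : ∀ M n, Measurable (W M n)) (hWt : Measurable Wt)
    (hpow : ∀ u ∈ Set.Icc (0 : ℝ) 1, BoundedL2Law W Wt (fun x => u ^ x)) (k : ℕ) :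
    BoundedL2Law W Wt (fun x => if x = k then 1 else 0) := by
  induction k using Nat.strong_induction_on with
  | _ k ih =>
    refine of_uniform_approx hW hWt fun ε hε hε1 =>
      ⟨fun x => (ε ^ k)⁻¹ * (ε ^ x + (-1) * ∑ l ∈ Finset.range k, ε ^ l * if x = l then 1 else 0),
        ((hpow ε ⟨hε.le, hε1⟩).add hW hWt ((sum hW hWt _ fun l hl =>
          (ih l (Finset.mem_range.1 hl)).const_mul _).const_mul _)).const_mul _, fun x => ?_⟩
    have hk : ε ^ k ≠ 0 := (pow_pos hε k).ne'
    simp only [mul_ite, mul_one, mul_zero, Finset.sum_ite_eq, Finset.mem_range]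
    rcases lt_trichotomy x k with h | rfl | h
    · simp [h, h.ne, hε.le]
    · simp [hk, hε.le]
    · obtain ⟨d, rfl⟩ := Nat.exists_eq_add_of_lt h
      have hd : ε ^ (d + 1) ≤ ε := by
        simpa using pow_le_pow_of_le_one hε.le hε1 (Nat.succ_le_succ (Nat.zero_le d))
      have e : (ε ^ k)⁻¹ * ε ^ (k + d + 1) = ε ^ (d + 1) := by
        rw [add_assoc, pow_add]
        field_simp
      rw [if_neg (by omega), if_neg (by omega), add_zero, e, zero_sub, abs_neg,
        abs_of_nonneg (by positivity)]
      exact hd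

lemma of_finite_support (hW : ∀ M n, Measurable (W M n)) (hWt : Measurable Wt)
    (hpow : ∀ u ∈ Set.Icc (0 : ℝ) 1, BoundedL2Law W Wt (fun x => u ^ x))
    {f : ℕ → ℝ} (hf : (Function.support f).Finite) : BoundedL2Law W Wt f := by
  have h := sum hW hWt hf.toFinset fun k _ => (indicator_of_pow hW hWt hpow k).const_mul (f k)
  convert h using 2 with x
  simp only [mul_ite, mul_one, mul_zero, Finset.sum_ite_eq, Set.Finite.mem_toFinset,
    Function.mem_support]
  split_ifs with hx
  · rfl
  · exact not_not.1 hx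

end BoundedL2Law

end EmpiricalMeans

/-- A weak law for `[-1, 1]`-valued variables with constant off-diagonal covariances. -/
lemma integral_sq_mean_le {Ω : Type*} [MeasureSpace Ω] [IsProbabilityMeasure (ℙ : Measure Ω)]
    {X : ℕ → Ω → ℝ} (hX : ∀ n, Measurable (X n)) (hX1 : ∀ n ω, |X n ω| ≤ 1) {M : ℕ}
    (hM : 0 < M) {b : ℝ}
    (hb : ∀ n < M, ∀ m < M, n ≠ m → ∫ ω, X n ω * X m ω = b) :
    ∫ ω, ((M : ℝ)⁻¹ * ∑ n ∈ Finset.range M, X n ω) ^ 2 ≤ (M : ℝ)⁻¹ + |b| := by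
  have hprod : ∀ n m ω, |X n ω * X m ω| ≤ 1 := fun n m ω => by
    rw [abs_mul]
    exact mul_le_one₀ (hX1 n ω) (abs_nonneg _) (hX1 m ω)
  have h_integrable : ∀ n m, Integrable (fun ω => X n ω * X m ω) := fun n m =>
    Integrable.of_bound ((hX n).mul (hX m)).aestronglyMeasurable 1
      (Eventually.of_forall (hprod n m))
  have hM' : (0 : ℝ) < M := by exact_mod_cast hM
  have hle : ∑ n ∈ Finset.range M, ∑ m ∈ Finset.range M, ∫ ω, X n ω * X m ω ≤
      M + M ^ 2 * |b| := by
    calc _ ≤ ∑ n ∈ Finset.range M, ∑ m ∈ Finset.range M, ((if n = m then 1 else 0) + |b|) := by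
          refine Finset.sum_le_sum fun n hn => Finset.sum_le_sum fun m hm => ?_
          split_ifs with h
          · have := integral_mono (h_integrable n m) (integrable_const 1)
              fun ω => (abs_le.1 (hprod n m ω)).2
            simp only [integral_const, probReal_univ, smul_eq_mul, mul_one] at this
            linarith [abs_nonneg b]
          · rw [hb n (Finset.mem_range.1 hn) m (Finset.mem_range.1 hm) h, zero_add]
            exact le_abs_self b
      _ = M + M ^ 2 * |b| := by
          simp only [Finset.sum_add_distrib, Finset.sum_ite_eq, Finset.sum_const,
            Finset.card_range, nsmul_eq_mul]
          rw [Finset.sum_congr rfl fun n hn => if_pos hn]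
          simp
          ring
  have hexp : ∫ ω, ((M : ℝ)⁻¹ * ∑ n ∈ Finset.range M, X n ω) ^ 2 =
      ((M : ℝ)⁻¹) ^ 2 *
        ∑ n ∈ Finset.range M, ∑ m ∈ Finset.range M, ∫ ω, X n ω * X m ω := by
    simp only [mul_pow, integral_const_mul]
    congr 1
    simp only [sq, Finset.sum_mul_sum]
    rw [integral_finsetSum _ fun n _ => integrable_finsetSum _ fun m _ => h_integrable n m]
    exact Finset.sum_congr rfl fun n _ => integral_finsetSum _ fun m _ => h_integrable n m
  rw [hexp]
  calc _ ≤ ((M : ℝ)⁻¹) ^ 2 * (M + M ^ 2 * |b|) := by gcongr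
    _ = (M : ℝ)⁻¹ + |b| := by field_simp

/-- Exchangeability carries the pair of indices `0, 1` to any pair of distinct indices. -/
lemma ExchangeablePairs.integral_pair {Ω : Type*} [MeasureSpace Ω] {K : ℕ}
    {Z : ℕ → ℕ → Fin K → Ω → ℕ} (hZ : ExchangeablePairs Z)
    (hZmeas : ∀ M n i, Measurable (Z M n i)) (i : Fin K) (F : ℕ × ℕ → ℝ) {M n m : ℕ}
    (hn : n < M) (hm : m < M) (hnm : n ≠ m) :
    ∫ ω, F (Z M n i ω, Z M m i ω) = ∫ ω, F (Z M 0 i ω, Z M 1 i ω) := by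
  let τ : Equiv.Perm ℕ := Equiv.swap (Equiv.swap 0 n 1) m * Equiv.swap 0 n
  have h0 : τ 0 = n := by
    have h : n ≠ Equiv.swap 0 n 1 := by
      intro h
      have h' := (Equiv.swap 0 n).injective (h.symm.trans (Equiv.swap_apply_left 0 n).symm)
      exact one_ne_zero h'
    simp only [τ, Equiv.Perm.mul_apply, Equiv.swap_apply_left]
    exact Equiv.swap_apply_of_ne_of_ne h hnm
  have h1 : τ 1 = m := by simp [τ]
  have hfix : ∀ p, M ≤ p → τ p = p := fun p hp => by
    have hs : Equiv.swap 0 n 1 < M := by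
      rw [Equiv.swap_apply_def]
      split_ifs <;> omega
    simp only [τ, Equiv.Perm.mul_apply]
    rw [Equiv.swap_apply_of_ne_of_ne (a := 0) (b := n) (x := p) (by omega) (by omega)]
    exact Equiv.swap_apply_of_ne_of_ne (by omega) (by omega)
  have hmap := hZ M (Equiv.prodCongr τ (Equiv.refl _)) fun p hp =>
    Prod.ext (hfix p.1 hp) rfl
  have hG : Measurable fun y : ℕ × Fin K → ℕ => F (y (0, i), y (1, i)) :=
    (measurable_of_countable F).comp
      ((measurable_pi_apply _).prodMk (measurable_pi_apply _))
  have e := congrArg (fun μ => ∫ y, F (y (0, i), y (1, i)) ∂μ) hmap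
  rw [integral_map (measurable_pi_lambda _ fun p => hZmeas _ _ _).aemeasurable
      hG.aestronglyMeasurable,
    integral_map (measurable_pi_lambda _ fun p => hZmeas _ _ _).aemeasurable
      hG.aestronglyMeasurable] at e
  simpa [h0, h1] using e

/-- The powers `x ↦ u ^ x` obey the law of large numbers under pairwise asymptotic
independence. -/
lemma boundedL2Law_pow {Ω : Type*} [MeasureSpace Ω] [IsProbabilityMeasure (ℙ : Measure Ω)]
    {K : ℕ} {Z : ℕ → ℕ → Fin K → Ω → ℕ} (hZmeas : ∀ M n i, Measurable (Z M n i))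
    (hZexch : ExchangeablePairs Z) {Zt : Ω → ℕ} (hPAI : PAI Z Zt)
    (i : Fin K) {u : ℝ} (hu : u ∈ Set.Icc (0 : ℝ) 1) :
    BoundedL2Law (fun M n => Z M n i) Zt (fun x => u ^ x) := by
  have hpos : ∀ x : ℕ, 0 ≤ u ^ x := fun x => pow_nonneg hu.1 x
  have hle : ∀ x : ℕ, u ^ x ≤ 1 := fun x => pow_le_one₀ hu.1 hu.2
  have habs : ∀ x : ℕ, |u ^ x| ≤ 1 := fun x => by rw [abs_of_nonneg (hpos x)]; exact hle x
  refine ⟨⟨1, habs⟩, ?_⟩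
  set c := ∫ ω, u ^ Zt ω with hc
  have hc0 : 0 ≤ c := integral_nonneg fun ω => hpos _
  have hc1 : c ≤ 1 := by
    have := norm_integral_le_of_norm_le_const (μ := (ℙ : Measure Ω))
      (f := fun ω => u ^ Zt ω) (C := 1) (Eventually.of_forall fun ω => habs _)
    rw [probReal_univ, mul_one] at this
    exact (le_abs_self _).trans this
  have hmeas : ∀ M n, Measurable fun ω => u ^ Z M n i ω := fun M n =>
    (measurable_of_countable fun x : ℕ => u ^ x).comp (hZmeas M n i)
  have h_integrable : ∀ M n, Integrable fun ω => u ^ Z M n i ω := fun M n =>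
    integrable_comp_nat_of_bounded (hZmeas M n i) habs
  have h_integrable_mul : ∀ M n m, Integrable fun ω => u ^ Z M n i ω * u ^ Z M m i ω := fun M n m =>
    Integrable.of_bound ((hmeas M n).mul (hmeas M m)).aestronglyMeasurable 1
      (Eventually.of_forall fun ω => by
        rw [norm_mul]
        exact mul_le_one₀ (habs _) (norm_nonneg _) (habs _))
  let b : ℕ → ℝ := fun M => ∫ ω, (u ^ Z M 0 i ω - c) * (u ^ Z M 1 i ω - c)
  have hone : (1 : ℝ) ∈ Set.Icc (0 : ℝ) 1 := ⟨zero_le_one, le_rfl⟩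
  have hne : ((0 : ℕ), i) ≠ (1, i) := by simp
  have hb : Tendsto b atTop (nhds 0) := by
    have l1 := hPAI 0 1 i i hne u u hu hu
    have l2 := hPAI 0 1 i i hne u 1 hu hone
    have l3 := hPAI 0 1 i i hne 1 u hone hu
    simp only [one_pow, mul_one, one_mul, integral_const, probReal_univ, smul_eq_mul] at l2 l3
    have l := ((l1.sub (l2.const_mul c)).sub (l3.const_mul c)).add_const (c ^ 2)
    rw [← hc, show c * c - c * c - c * c + c ^ 2 = 0 by ring] at l
    refine l.congr fun M => ?_
    have e : ∀ ω, (u ^ Z M 0 i ω - c) * (u ^ Z M 1 i ω - c) =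
        u ^ Z M 0 i ω * u ^ Z M 1 i ω - c * u ^ Z M 0 i ω - c * u ^ Z M 1 i ω + c ^ 2 :=
      fun ω => by ring
    simp only [b, e]
    have j0 := (h_integrable M 0).const_mul c
    have j1 := (h_integrable M 1).const_mul c
    have j2 : Integrable fun ω => u ^ Z M 0 i ω * u ^ Z M 1 i ω - c * u ^ Z M 0 i ω :=
      (h_integrable_mul M 0 1).sub j0
    have j3 : Integrable fun ω =>
        u ^ Z M 0 i ω * u ^ Z M 1 i ω - c * u ^ Z M 0 i ω - c * u ^ Z M 1 i ω := j2.sub j1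
    rw [integral_add j3 (integrable_const _), integral_sub j2 j1,
      integral_sub (h_integrable_mul M 0 1) j0, integral_const_mul, integral_const_mul, integral_const,
      probReal_univ, one_smul]
  have hlim : Tendsto (fun M : ℕ => (M : ℝ)⁻¹ + |b M|) atTop (nhds 0) := by
    simpa using tendsto_inv_atTop_nhds_zero_nat.add hb.abs
  refine squeeze_zero' (Eventually.of_forall fun M => integral_nonneg fun ω => sq_nonneg _)
    ?_ hlim
  filter_upwards [eventually_gt_atTop 0] with M hM
  have hM' : (M : ℝ) ≠ 0 := by exact_mod_cast hM.ne'
  have hmean := integral_sq_mean_le (X := fun n ω => u ^ Z M n i ω - c) (M := M) (b := b M)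
    (fun n => (hmeas M n).sub_const c)
    (fun n ω => abs_le.2 ⟨by linarith [hpos (Z M n i ω)], by linarith [hle (Z M n i ω)]⟩) hM
    fun n hn m hm hnm => hZexch.integral_pair hZmeas i
      (fun p => (u ^ p.1 - c) * (u ^ p.2 - c)) hn hm hnm
  refine le_of_eq_of_le ?_ hmean
  congr 1 with ω
  simp only [meanDeviation, Finset.sum_sub_distrib, Finset.sum_const, Finset.card_range,
    nsmul_eq_mul, mul_sub, ← hc, inv_mul_cancel_left₀ hM']

/-- **Lemma (PAI implies the triangular law of large numbers).** If the array
`Z = {Z^M_{n,i}}` satisfies `PAI(Z)` with limit `Z̃`, then for every `i`, the array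
`Z_i = {Z^M_{n,i}}` satisfies `TLLN(Z_i)` with limit `Z̃`: for every `f : ℕ → ℝ` with
finite support, `(1/M) Σ_{n=1}^M f(Z^M_{n,i}) → E[f(Z̃)]` in `L²` as `M → ∞`. -/
theorem pai_implies_tlln
    {Ω : Type*} [MeasureSpace Ω] [IsProbabilityMeasure (ℙ : Measure Ω)]
    {K : ℕ} (hK : 2 ≤ K)
    (Z : ℕ → ℕ → Fin K → Ω → ℕ) (hZmeas : ∀ M n i, Measurable (Z M n i))
    (hZexch : ExchangeablePairs Z)
    (Zt : Ω → ℕ) (hZtmeas : Measurable Zt) (hPAI : PAI Z Zt) :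
    ∀ (i : Fin K) (f : ℕ → ℝ), (Function.support f).Finite →
      Tendsto
        (fun M : ℕ => ∫ ω,
          ((M : ℝ)⁻¹ * ∑ n ∈ Finset.range M, f (Z M n i ω) - ∫ ω', f (Zt ω')) ^ 2)
        atTop (nhds 0) := by
  intro i f hf
  exact (BoundedL2Law.of_finite_support (fun M n => hZmeas M n i) hZtmeas
    (fun u hu => boundedL2Law_pow hZmeas hZexch hPAI i hu) hf).2
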